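/- Fix b₀ > 0, θ₀ = arctan b₀, δ, δ₀, α ∈ (0, 1), and L ≥ 4. Let Q = {y ∈ ℝ³ : y₁ > 0, y₃ > b₀y₁} and let f ∈ H^{(1−δ,2−δ₀)}_{1,α}(Q) be 2π-periodic in y₂, written f(r, θ, y₂) in cylindrical coordinates. Define I₀, K₀, I₀′, K₀′, f^{(2)}_{0n} and R^{(2)}_{0n} as in the Fourier–Bessel construction, set f_{00}(r) = (1/(2π(π/2 − θ₀)))·∫_{θ₀}^{π/2}∫₀^{2π} f(r, θ, y₂) dy₂ dθ, and define R₀₀(r) = −Σ_{n=1}^{∞} R^{(2)}_{0n}(0) + ∫₀^{r} η^{−1} ( ∫₀^{η} ξ f_{00}(ξ) dξ ) dη, where R^{(2)}_{0n}(0) = (K₀′(nL)/I₀′(nL))·∫₀^{L} s I₀(ns) f^{(2)}_{0n}(s) ds − ∫₀^{L} s K₀(ns) f^{(2)}_{0n}(s) ds. Then there is a constant C, independent of L and f, such that sup_{0<r≤1} |R₀₀(r)| + sup_{1<r≤L} r^{−δ₀}|R₀₀(r)| ≤ C·‖f‖^{(1−δ,2−δ₀)}_{1,α;Q}. -/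

import Mathlib

noncomputable section

open Real Set Filter MeasureTheory Topology

/-- Points of `ℝ³` (Euclidean). -/
abbrev V3 : Type := EuclideanSpace ℝ (Fin 3)

/-- `r_x = √(x₁² + x₃²)`, the distance of `x` to the `x₂`-axis. -/
def rx (x : V3) : ℝ := Real.sqrt (x 0 ^ 2 + x 2 ^ 2)

/-- The edge `{x₁ = x₃ = 0}` (the `x₂`-axis). -/
def edge : Set V3 := {x : V3 | x 0 = 0 ∧ x 2 = 0}

/-- The infinite wedge `Q = {y₁ > 0, y₃ > b₀y₁}`. -/
def wedgeQ (b₀ : ℝ) : Set V3 := {y : V3 | 0 < y 0 ∧ b₀ * y 0 < y 2}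

/-- The truncated wedge `Q_L = Q ∩ {r < L}`. -/
def wedgeQL (b₀ L : ℝ) : Set V3 := {y ∈ wedgeQ b₀ | rx y < L}

/-- `Q̄ ∖ edge`, the natural regularity set for functions on the wedge. -/
def SQ (b₀ : ℝ) : Set V3 := closure (wedgeQ b₀) \ edge

/-- `Q̄_L ∖ edge`. -/
def SL (b₀ L : ℝ) : Set V3 := closure (wedgeQL b₀ L) \ edge

/-- Partial derivative within `S` in the `i`-th coordinate direction. -/
def pdW (S : Set V3) (i : Fin 3) (u : V3 → ℝ) (x : V3) : ℝ :=
  fderivWithin ℝ u S x (EuclideanSpace.single i 1)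

/-- Laplacian of `u` at `x` (derivatives taken within `S`). -/
def lapW (S : Set V3) (u : V3 → ℝ) (x : V3) : ℝ :=
  ∑ i : Fin 3, pdW S i (pdW S i u) x

/-- `2π`-periodicity in `y₂`, on the set `D`. -/
def Per2On (D : Set V3) (u : V3 → ℝ) : Prop :=
  ∀ y ∈ D, u (y + EuclideanSpace.single 1 (2 * Real.pi)) = u y

/-- All weighted sup quantities entering `Σ_{j≤m}[u]^{(k,l)}_{j,0;D}` are `≤ M`
(derivatives taken within `S`). -/
def wsupLE (S : Set V3) (m : ℕ) (k l : ℝ) (D : Set V3) (u : V3 → ℝ) (M : ℝ) : Prop :=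
  (∀ j : ℕ, j ≤ m → ∀ x ∈ D, 0 < rx x → rx x < 1 →
      rx x ^ max (k + j) 0 * ‖iteratedFDerivWithin ℝ j u S x‖ ≤ M) ∧
  (∀ j : ℕ, j ≤ m → ∀ x ∈ D, 1 < rx x →
      rx x ^ (l + j) * ‖iteratedFDerivWithin ℝ j u S x‖ ≤ M)

/-- All quantities entering the weighted Hölder norm `‖u‖^{(k,l)}_{m,α;D}` are `≤ M`
(derivatives taken within `S`). -/
def wnormLE (S : Set V3) (m : ℕ) (α k l : ℝ) (D : Set V3) (u : V3 → ℝ) (M : ℝ) : Prop :=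
  wsupLE S m k l D u M ∧
  (∀ x ∈ D, ∀ y ∈ D, 0 < min (rx x) (rx y) → min (rx x) (rx y) < 1 →
      min (rx x) (rx y) ^ max (k + m + α) 0 *
        ‖iteratedFDerivWithin ℝ m u S x - iteratedFDerivWithin ℝ m u S y‖ ≤
        M * ‖x - y‖ ^ α) ∧
  (∀ x ∈ D, ∀ y ∈ D, 1 < min (rx x) (rx y) →
      min (rx x) (rx y) ^ (l + m + α) *
        ‖iteratedFDerivWithin ℝ m u S x - iteratedFDerivWithin ℝ m u S y‖ ≤
        M * ‖x - y‖ ^ α)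

/-- Membership in the weighted Hölder space `H^{(k,l)}_{m,α}(D)`. -/
def memH (S : Set V3) (m : ℕ) (α k l : ℝ) (D : Set V3) (u : V3 → ℝ) : Prop :=
  ContDiffOn ℝ m u S ∧ ∃ M : ℝ, 0 ≤ M ∧ wnormLE S m α k l D u M

/-- The point of `ℝ³` with cylindrical coordinates `(r, θ, y₂)`:
`(r cos θ, y₂, r sin θ)`. -/
def mk3 (a b c : ℝ) : V3 := (WithLp.equiv 2 (Fin 3 → ℝ)).symm ![a, b, c]

/-- `f` written in cylindrical coordinates: `f(r cos θ, y₂, r sin θ)`. -/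
def fPolar (f : V3 → ℝ) (r θ y₂ : ℝ) : ℝ := f (mk3 (r * Real.cos θ) y₂ (r * Real.sin θ))

/-- Modified Bessel function of the first kind of order `0`, by its integral representation. -/
def besselI0 (t : ℝ) : ℝ :=
  2 * Real.exp t / Real.pi *
    ∫ u in (0:ℝ)..1, Real.exp (-2 * t * u ^ 2) * (1 - u ^ 2) ^ (-(1:ℝ)/2)

/-- Modified Bessel function of the second kind of order `0`, by its integral representation. -/
def besselK0 (t : ℝ) : ℝ :=
  Real.exp (-t) / Real.sqrt (2 * t) *
    ∫ u in Set.Ioi (0:ℝ), Real.exp (-u) * u ^ (-(1:ℝ)/2) * (1 + u / (2 * t)) ^ (-(1:ℝ)/2)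

/-- The Fourier coefficient `f^{(2)}_{0n}(r)` (against `cos(ny₂)`). -/
def f0n2 (b₀ : ℝ) (f : V3 → ℝ) (n : ℕ) (r : ℝ) : ℝ :=
  (Real.pi * (Real.pi / 2 - Real.arctan b₀))⁻¹ *
    ∫ θ in (Real.arctan b₀)..(Real.pi / 2), ∫ y₂ in (0:ℝ)..(2 * Real.pi),
      fPolar f r θ y₂ * Real.cos (n * y₂)

/-- The mean Fourier coefficient `f_{00}(r)`. -/
def f00 (b₀ : ℝ) (f : V3 → ℝ) (r : ℝ) : ℝ :=
  (2 * Real.pi * (Real.pi / 2 - Real.arctan b₀))⁻¹ *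
    ∫ θ in (Real.arctan b₀)..(Real.pi / 2), ∫ y₂ in (0:ℝ)..(2 * Real.pi), fPolar f r θ y₂

/-- The value `R^{(2)}_{0n}(0)` (using `I₀(0) = 1`). -/
def R0n2At0 (b₀ L : ℝ) (f : V3 → ℝ) (n : ℕ) : ℝ :=
  deriv besselK0 (n * L) / deriv besselI0 (n * L) *
      (∫ s in (0:ℝ)..L, s * besselI0 (n * s) * f0n2 b₀ f n s) -
    ∫ s in (0:ℝ)..L, s * besselK0 (n * s) * f0n2 b₀ f n s

/-- The radially symmetric mode `R₀₀(r)` of (4.23). -/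
def R00 (b₀ L : ℝ) (f : V3 → ℝ) (r : ℝ) : ℝ :=
  -(∑' n : ℕ, R0n2At0 b₀ L f (n + 1)) +
    ∫ η in (0:ℝ)..r, η⁻¹ * ∫ ξ in (0:ℝ)..η, ξ * f00 b₀ f ξ

theorem h_deriv_ge (g : ℝ → ℝ) (t A : ℝ) (hd : DifferentiableAt ℝ g t)
    (h : ∀ y, t < y → A * (y - t) ≤ g y - g t) : A ≤ deriv g t := by
  have h1 := (hasDerivWithinAt_iff_tendsto_slope' (by simp : t ∉ Ioi t)).1
    (hd.hasDerivAt.hasDerivWithinAt (s := Ioi t))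
  refine ge_of_tendsto h1 ?_
  filter_upwards [self_mem_nhdsWithin] with y hy
  have hy' : 0 < y - t := sub_pos.2 hy
  rw [slope_def_field, le_div_iff₀ hy']
  exact h y hy

theorem h_deriv_le (g : ℝ → ℝ) (t A : ℝ) (hd : DifferentiableAt ℝ g t)
    (h : ∀ y, t < y → g y - g t ≤ A * (y - t)) : deriv g t ≤ A := by
  have h1 := (hasDerivWithinAt_iff_tendsto_slope' (by simp : t ∉ Ioi t)).1
    (hd.hasDerivAt.hasDerivWithinAt (s := Ioi t))
  refine le_of_tendsto h1 ?_
  filter_upwards [self_mem_nhdsWithin] with y hy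
  have hy' : 0 < y - t := sub_pos.2 hy
  rw [slope_def_field, div_le_iff₀ hy']
  exact h y hy

theorem h_image : Real.sin '' Ioo 0 (Real.pi / 2) = Ioo 0 1 := by
  ext y
  constructor
  · rintro ⟨x, ⟨h1, h2⟩, rfl⟩
    refine ⟨Real.sin_pos_of_pos_of_lt_pi h1 (by linarith [Real.pi_pos]), ?_⟩
    have := Real.sin_lt_sin_of_lt_of_le_pi_div_two (by linarith [Real.pi_pos]) le_rfl h2
    simpa using this
  · rintro ⟨h1, h2⟩
    exact ⟨Real.arcsin y, ⟨Real.arcsin_pos.2 h1, Real.arcsin_lt_pi_div_two.2 h2⟩,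
      Real.sin_arcsin (by linarith) h2.le⟩

theorem h_I0_exp (t : ℝ) : besselI0 t =
    2 / Real.pi * ∫ x in (0:ℝ)..(Real.pi / 2), Real.exp (t * Real.cos (2 * x)) := by
  have hpi := Real.pi_pos
  have hinj : InjOn Real.sin (Ioo 0 (Real.pi / 2)) :=
    Set.InjOn.mono (fun x hx => mem_Icc.2 ⟨by linarith [hx.1], hx.2.le⟩) Real.injOn_sin
  unfold besselI0
  rw [intervalIntegral.integral_of_le zero_le_one, integral_Ioc_eq_integral_Ioo, ← h_image,
    integral_image_eq_integral_abs_deriv_smul measurableSet_Ioo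
      (fun x _ => (Real.hasDerivAt_sin x).hasDerivWithinAt)
      hinj,
    intervalIntegral.integral_of_le (by positivity), integral_Ioc_eq_integral_Ioo]
  rw [show 2 * Real.exp t / Real.pi = 2 / Real.pi * Real.exp t by ring, mul_assoc,
    ← integral_const_mul]
  congr 1
  refine setIntegral_congr_fun measurableSet_Ioo (fun x hx => ?_)
  have hc : 0 < Real.cos x := Real.cos_pos_of_mem_Ioo ⟨by linarith [hx.1], hx.2⟩
  have e1 : (1 - Real.sin x ^ 2) ^ (-(1:ℝ)/2) = (Real.cos x)⁻¹ := by
    rw [← Real.cos_sq', ← Real.rpow_natCast, ← Real.rpow_mul hc.le]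
    norm_num [Real.rpow_neg_one]
  simp only [smul_eq_mul]
  rw [e1, abs_of_pos hc, Real.cos_two_mul, Real.cos_sq',
    show t * (2 * (1 - Real.sin x ^ 2) - 1) = t + (-2 * t * Real.sin x ^ 2) by ring, Real.exp_add]
  field_simp

theorem h_I0_cosh (t : ℝ) : besselI0 t =
    2 / Real.pi * ∫ x in (0:ℝ)..(Real.pi / 2), Real.cosh (t * Real.cos (2 * x)) := by
  rw [h_I0_exp]
  congr 1
  have h1 : ∫ x in (0:ℝ)..(Real.pi / 2), Real.exp (t * Real.cos (2 * x)) =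
      ∫ x in (0:ℝ)..(Real.pi / 2), Real.exp (-(t * Real.cos (2 * x))) := by
    have := intervalIntegral.integral_comp_sub_left (a := 0) (b := Real.pi / 2)
      (fun x => Real.exp (t * Real.cos (2 * x))) (Real.pi / 2)
    simp only [sub_self, sub_zero] at this
    rw [← this]
    congr 1
    ext x
    rw [show 2 * (Real.pi / 2 - x) = Real.pi - 2 * x by ring, Real.cos_pi_sub, mul_neg]
  simp only [Real.cosh_eq]
  rw [intervalIntegral.integral_div, intervalIntegral.integral_add, ← h1]
  · ring
  · exact Continuous.intervalIntegrable (by fun_prop) _ _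
  · exact Continuous.intervalIntegrable (by fun_prop) _ _

theorem h_I0_nonneg (t : ℝ) : 0 ≤ besselI0 t := by
  rw [h_I0_exp]
  refine mul_nonneg (by positivity) (intervalIntegral.integral_nonneg (by positivity) ?_)
  intro x _
  positivity

theorem h_I0_le (t : ℝ) (ht : 0 ≤ t) : besselI0 t ≤ Real.exp t := by
  rw [h_I0_exp]
  have hpi := Real.pi_pos
  have : ∫ x in (0:ℝ)..(Real.pi / 2), Real.exp (t * Real.cos (2 * x)) ≤
      ∫ x in (0:ℝ)..(Real.pi / 2), Real.exp t := by
    refine intervalIntegral.integral_mono_on (by positivity)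
      (Continuous.intervalIntegrable (by fun_prop) _ _)
      (Continuous.intervalIntegrable (by fun_prop) _ _) (fun x _ => ?_)
    exact Real.exp_le_exp.2 (by nlinarith [Real.cos_le_one (2 * x)])
  calc _ ≤ 2 / Real.pi * ∫ x in (0:ℝ)..(Real.pi / 2), Real.exp t := by gcongr
    _ = Real.exp t := by
      rw [intervalIntegral.integral_const]; simp; field_simp

theorem h_sinh_cube (x : ℝ) (hx : 0 ≤ x) : 4 / 27 * x ^ 3 ≤ Real.sinh x := by
  have h1 : Real.sinh x = 4 * Real.sinh (x / 3) ^ 3 + 3 * Real.sinh (x / 3) := by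
    rw [← Real.sinh_three_mul]; congr 1; ring
  have h2 : x / 3 ≤ Real.sinh (x / 3) := Real.self_le_sinh_iff.2 (by positivity)
  have h3 : (x / 3) ^ 3 ≤ Real.sinh (x / 3) ^ 3 := by gcongr
  have h4 : 0 ≤ x / 3 := by positivity
  nlinarith

theorem h_cosh_diff (t y c : ℝ) (ht : 0 ≤ t) (hy : t ≤ y) :
    (y - t) * t ^ 3 * (4 / 27 * c ^ 4) ≤ Real.cosh (y * c) - Real.cosh (t * c) := by
  wlog hc : 0 ≤ c generalizing c
  · have := this (-c) (by linarith)
    simpa [mul_neg, Real.cosh_neg, Even.neg_pow (show Even 4 by decide)] using this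
  have h1 : Real.cosh (y * c) = Real.cosh ((y - t) * c) * Real.cosh (t * c) +
      Real.sinh ((y - t) * c) * Real.sinh (t * c) := by
    rw [← Real.cosh_add]; congr 1; ring
  have h2 := Real.one_le_cosh ((y - t) * c)
  have hyt : 0 ≤ (y - t) * c := mul_nonneg (by linarith) hc
  have h3 : (y - t) * c ≤ Real.sinh ((y - t) * c) := Real.self_le_sinh_iff.2 hyt
  have h4 := h_sinh_cube (t * c) (by positivity)
  have h5 : 0 ≤ Real.cosh (t * c) := by positivity
  have h6 : ((y - t) * c) * (4 / 27 * (t * c) ^ 3) ≤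
      Real.sinh ((y - t) * c) * Real.sinh (t * c) :=
    mul_le_mul h3 h4 (by positivity) (hyt.trans h3)
  nlinarith

theorem h_I0_deriv : ∃ κ : ℝ, 0 < κ ∧ ∀ t : ℝ, 0 ≤ t → DifferentiableAt ℝ besselI0 t →
    κ * t ^ 3 ≤ deriv besselI0 t := by
  have hpi := Real.pi_pos
  refine ⟨2 / Real.pi * ∫ x in (0:ℝ)..(Real.pi / 2), 4 / 27 * Real.cos (2 * x) ^ 4, ?_, ?_⟩
  · refine mul_pos (by positivity) (intervalIntegral.integral_pos (by positivity)
      (Continuous.continuousOn (by fun_prop)) (fun x _ => by positivity) ⟨0, ⟨le_rfl, by positivity⟩, ?_⟩)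
    simp
  · intro t ht hd
    refine h_deriv_ge _ _ _ hd (fun y hy => ?_)
    rw [h_I0_cosh, h_I0_cosh, ← mul_sub, ← intervalIntegral.integral_sub
      (Continuous.intervalIntegrable (by fun_prop) _ _)
      (Continuous.intervalIntegrable (by fun_prop) _ _)]
    have : ∫ x in (0:ℝ)..(Real.pi / 2), (y - t) * t ^ 3 * (4 / 27 * Real.cos (2 * x) ^ 4) ≤
        ∫ x in (0:ℝ)..(Real.pi / 2),
          (Real.cosh (y * Real.cos (2 * x)) - Real.cosh (t * Real.cos (2 * x))) :=
      intervalIntegral.integral_mono_on (by positivity)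
        (Continuous.intervalIntegrable (by fun_prop) _ _)
        (Continuous.intervalIntegrable (by fun_prop) _ _)
        (fun x _ => h_cosh_diff t y _ ht hy.le)
    rw [intervalIntegral.integral_const_mul] at this
    have h2 : (0:ℝ) ≤ 2 / Real.pi := by positivity
    have := mul_le_mul_of_nonneg_left this h2
    linarith

/-- The integral in the definition of `K₀`. -/
def hJ (t : ℝ) : ℝ :=
  ∫ u in Set.Ioi (0:ℝ), Real.exp (-u) * u ^ (-(1:ℝ)/2) * (1 + u / (2 * t)) ^ (-(1:ℝ)/2)

theorem h_gam_int : IntegrableOn (fun u : ℝ => Real.exp (-u) * u ^ (-(1:ℝ)/2)) (Ioi 0) := by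
  have := Real.GammaIntegral_convergent (s := 1/2) (by norm_num)
  convert this using 5
  norm_num

theorem h_fac (t u : ℝ) (ht : 0 < t) (hu : 0 < u) :
    0 ≤ (1 + u / (2 * t)) ^ (-(1:ℝ)/2) ∧ (1 + u / (2 * t)) ^ (-(1:ℝ)/2) ≤ 1 := by
  have : 0 ≤ u / (2 * t) := by positivity
  exact ⟨by positivity, Real.rpow_le_one_of_one_le_of_nonpos (by linarith) (by norm_num)⟩

theorem h_J_int (t : ℝ) (ht : 0 < t) : IntegrableOn (fun u : ℝ =>
    Real.exp (-u) * u ^ (-(1:ℝ)/2) * (1 + u / (2 * t)) ^ (-(1:ℝ)/2)) (Ioi 0) := by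
  refine Integrable.mono' h_gam_int (Measurable.aestronglyMeasurable (by fun_prop)) ?_
  filter_upwards [ae_restrict_mem measurableSet_Ioi] with u hu
  have hu' : 0 < u := hu
  obtain ⟨h1, h2⟩ := h_fac t u ht hu'
  rw [Real.norm_of_nonneg (by positivity)]
  exact mul_le_of_le_one_right (by positivity) h2

theorem h_J_nonneg (t : ℝ) (ht : 0 < t) : 0 ≤ hJ t := by
  refine setIntegral_nonneg measurableSet_Ioi (fun u hu => ?_)
  have hu' : 0 < u := hu
  have := (h_fac t u ht hu').1
  positivity

theorem h_J_le (t : ℝ) (ht : 0 < t) : hJ t ≤ 2 := by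
  have h1 : hJ t ≤ ∫ u in Ioi (0:ℝ), Real.exp (-u) * u ^ (-(1:ℝ)/2) := by
    refine setIntegral_mono_on (h_J_int t ht) h_gam_int measurableSet_Ioi (fun u hu => ?_)
    have hu' : 0 < u := hu
    exact mul_le_of_le_one_right (by positivity) (h_fac t u ht hu').2
  have h2 : ∫ u in Ioi (0:ℝ), Real.exp (-u) * u ^ (-(1:ℝ)/2) = √Real.pi := by
    rw [← Real.Gamma_one_half_eq, Real.Gamma_eq_integral (by norm_num)]
    norm_num
  rw [h2] at h1
  refine h1.trans (Real.sqrt_le_iff.2 ⟨by norm_num, ?_⟩)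
  linarith [Real.pi_le_four]

theorem h_J_mono (t y : ℝ) (ht : 0 < t) (hy : t ≤ y) : hJ t ≤ hJ y := by
  refine setIntegral_mono_on (h_J_int t ht) (h_J_int y (ht.trans_le hy)) measurableSet_Ioi
    (fun u hu => ?_)
  have hu' : 0 < u := hu
  have hy' : 0 < y := ht.trans_le hy
  refine mul_le_mul_of_nonneg_left ?_ (by positivity)
  refine Real.rpow_le_rpow_of_nonpos (by positivity) ?_ (by norm_num)
  gcongr

theorem h_K0_eq (t : ℝ) : besselK0 t = Real.exp (-t) / √(2 * t) * hJ t := rfl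

theorem h_comb (t u : ℝ) (ht : 0 < t) (hu : 0 < u) :
    (√(2 * t))⁻¹ * (1 + u / (2 * t)) ^ (-(1:ℝ)/2) = (2 * t + u) ^ (-(1:ℝ)/2) := by
  rw [Real.sqrt_eq_rpow, ← Real.rpow_neg (by positivity), show -(1/2:ℝ) = -1/2 by norm_num,
    ← Real.mul_rpow (by positivity) (by positivity)]
  congr 1
  field_simp

theorem h_K0_anti (t y : ℝ) (ht : 0 < t) (hy : t ≤ y) : besselK0 y ≤ besselK0 t := by
  have hy' : 0 < y := ht.trans_le hy
  unfold besselK0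
  rw [← integral_const_mul, ← integral_const_mul]
  refine setIntegral_mono_on ((h_J_int y hy').const_mul _) ((h_J_int t ht).const_mul _)
    measurableSet_Ioi (fun u hu => ?_)
  have hu' : 0 < u := hu
  have key : ∀ s : ℝ, 0 < s → Real.exp (-s) / √(2 * s) *
      (Real.exp (-u) * u ^ (-(1:ℝ)/2) * (1 + u / (2 * s)) ^ (-(1:ℝ)/2)) =
      Real.exp (-s) * (2 * s + u) ^ (-(1:ℝ)/2) * (Real.exp (-u) * u ^ (-(1:ℝ)/2)) := by
    intro s hs
    rw [← h_comb s u hs hu', div_eq_mul_inv]; ring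
  rw [key y hy', key t ht]
  have : (2 * y + u) ^ (-(1:ℝ)/2) ≤ (2 * t + u) ^ (-(1:ℝ)/2) :=
    Real.rpow_le_rpow_of_nonpos (by positivity) (by linarith) (by norm_num)
  gcongr

theorem h_P_diff (t y : ℝ) (ht : 1 ≤ t) (hy : t < y) :
    Real.exp (-t) / √(2 * t) - Real.exp (-y) / √(2 * y) ≤ 2 * Real.exp (-t) * (y - t) := by
  have ht0 : 0 < t := by linarith
  have hy0 : 0 < y := by linarith
  have hst : 1 ≤ √(2 * t) := Real.one_le_sqrt.2 (by linarith)
  have e1 : Real.exp (-y) = Real.exp (-t) * Real.exp (-(y - t)) := by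
    rw [← Real.exp_add]; congr 1; ring
  have h1 : √(2 * t) / √(2 * y) ≥ t / y := by
    rw [← Real.sqrt_div (by positivity), show 2 * t / (2 * y) = t / y by field_simp]
    have h0 : 0 ≤ t / y := by positivity
    have h1 : t / y ≤ 1 := (div_le_one hy0).2 hy.le
    exact Real.le_sqrt_of_sq_le (by nlinarith)
  have h2 : t / y ≥ Real.exp (-(y - t)) := by
    rw [ge_iff_le, Real.exp_neg, inv_le_comm₀ (Real.exp_pos _) (by positivity), inv_div]
    have := Real.add_one_le_exp (y - t)
    refine le_trans ?_ this
    rw [div_le_iff₀ ht0]; nlinarith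
  have h3 : 1 - √(2 * t) / √(2 * y) * Real.exp (-(y - t)) ≤ 2 * (y - t) := by
    have h4 := Real.add_one_le_exp (-(2 * (y - t)))
    have h5 : Real.exp (-(2 * (y - t))) = Real.exp (-(y - t)) * Real.exp (-(y - t)) := by
      rw [← Real.exp_add]; congr 1; ring
    have : Real.exp (-(y - t)) * Real.exp (-(y - t)) ≤
        √(2 * t) / √(2 * y) * Real.exp (-(y - t)) := by
      gcongr; exact h2.trans h1
    linarith
  have hsy : 0 < √(2 * y) := by positivity
  have e2 : Real.exp (-t) / √(2 * t) - Real.exp (-y) / √(2 * y) = Real.exp (-t) / √(2 * t) *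
      (1 - √(2 * t) / √(2 * y) * Real.exp (-(y - t))) := by
    rw [e1]; field_simp
  rw [e2]
  have h6 : Real.exp (-t) / √(2 * t) ≤ Real.exp (-t) := div_le_self (by positivity) hst
  calc _ ≤ Real.exp (-t) / √(2 * t) * (2 * (y - t)) := by gcongr
    _ ≤ Real.exp (-t) * (2 * (y - t)) := by
      have : 0 ≤ y - t := by linarith
      gcongr
    _ = _ := by ring

theorem h_K0_deriv (t : ℝ) (ht : 1 ≤ t) : |deriv besselK0 t| ≤ 4 * Real.exp (-t) := by
  have ht0 : 0 < t := by linarith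
  by_cases hd : DifferentiableAt ℝ besselK0 t
  · rw [abs_le]
    constructor
    · refine h_deriv_ge _ _ _ hd (fun y hy => ?_)
      have hy0 : 0 < y := by linarith
      rw [h_K0_eq, h_K0_eq]
      have a1 := h_P_diff t y ht hy
      have a2 := h_J_mono t y ht0 hy.le
      have a3 := h_J_le y hy0
      have a4 := h_J_nonneg y hy0
      have a5 : 0 ≤ Real.exp (-t) / √(2 * t) := by positivity
      have a6 : 0 ≤ Real.exp (-t) * (y - t) := mul_nonneg (Real.exp_pos _).le (by linarith)
      have b1 := mul_le_mul_of_nonneg_right a1 a4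
      have b2 := mul_le_mul_of_nonneg_left a2 a5
      have b3 := mul_le_mul_of_nonneg_left a3 a6
      nlinarith
    · refine h_deriv_le _ _ _ hd (fun y hy => ?_)
      have := h_K0_anti t y ht0 hy.le
      have a6 : 0 ≤ Real.exp (-t) * (y - t) := mul_nonneg (Real.exp_pos _).le (by linarith)
      nlinarith
  · rw [deriv_zero_of_not_differentiableAt hd]
    simp; positivity

theorem h_ratio : ∃ A : ℝ, 0 < A ∧ ∀ t : ℝ, 1 ≤ t →
    |deriv besselK0 t / deriv besselI0 t| ≤ A * Real.exp (-t) / t ^ 2 := by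
  obtain ⟨κ, hκ, h⟩ := h_I0_deriv
  refine ⟨4 / κ, by positivity, fun t ht => ?_⟩
  have ht0 : 0 < t := by linarith
  by_cases hd : DifferentiableAt ℝ besselI0 t
  · have h1 := h t ht0.le hd
    have h2 : κ * t ^ 2 ≤ deriv besselI0 t := by
      refine le_trans ?_ h1
      gcongr <;> norm_num [ht]
    have h3 := h_K0_deriv t ht
    rw [abs_div]
    have h4 : 0 < κ * t ^ 2 := by positivity
    rw [abs_of_pos (h4.trans_le h2)]
    calc _ ≤ 4 * Real.exp (-t) / (κ * t ^ 2) := by gcongr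
      _ = _ := by field_simp
  · rw [deriv_zero_of_not_differentiableAt hd]
    simp; positivity

theorem h_K0_bound (t : ℝ) (ht : 0 < t) :
    0 ≤ besselK0 t ∧ besselK0 t ≤ 2 * Real.exp (-t) * t ^ (-(1:ℝ)/2) := by
  rw [h_K0_eq]
  have a3 := h_J_le t ht
  have a4 := h_J_nonneg t ht
  refine ⟨by positivity, ?_⟩
  have e : t ^ (-(1:ℝ)/2) = (√t)⁻¹ := by
    rw [Real.sqrt_eq_rpow, ← Real.rpow_neg ht.le]; norm_num
  rw [e]
  have : √t ≤ √(2 * t) := Real.sqrt_le_sqrt (by linarith)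
  have hs : 0 < √t := by positivity
  calc _ ≤ Real.exp (-t) / √t * 2 := by gcongr
    _ = _ := by rw [div_eq_mul_inv]; ring

theorem h_rx_mk3 (r θ y : ℝ) (hr : 0 ≤ r) :
    rx (mk3 (r * Real.cos θ) y (r * Real.sin θ)) = r := by
  have : (r * Real.cos θ) ^ 2 + (r * Real.sin θ) ^ 2 = r ^ 2 := by
    have := Real.sin_sq_add_cos_sq θ
    linear_combination r ^ 2 * this
  simp [rx, mk3, this, Real.sqrt_sq hr]

theorem h_mem (b₀ r θ y : ℝ) (hr : 0 < r) (h1 : Real.arctan b₀ < θ) (h2 : θ < Real.pi / 2) :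
    mk3 (r * Real.cos θ) y (r * Real.sin θ) ∈ wedgeQ b₀ := by
  have hθ : -(Real.pi / 2) < θ := (Real.neg_pi_div_two_lt_arctan b₀).trans h1
  have hc : 0 < Real.cos θ := Real.cos_pos_of_mem_Ioo ⟨hθ, h2⟩
  have ht : b₀ < Real.tan θ := by
    have := Real.tan_lt_tan_of_lt_of_lt_pi_div_two (Real.neg_pi_div_two_lt_arctan b₀) h2 h1
    rwa [Real.tan_arctan] at this
  rw [Real.tan_eq_sin_div_cos, lt_div_iff₀ hc] at ht
  simp only [wedgeQ, mk3, mem_setOf_eq]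
  constructor
  · simpa using mul_pos hr hc
  · simp
    nlinarith

theorem h_f_bound (b₀ α δ δ₀ : ℝ) (hδ0 : 0 < δ) (hδ1 : δ < 1) (hδ₀0 : 0 < δ₀) (hδ₀1 : δ₀ < 1)
    (f : V3 → ℝ) (Mf : ℝ) (hM : 0 ≤ Mf)
    (hw : wnormLE (SQ b₀) 1 α (1 - δ) (2 - δ₀) (wedgeQ b₀) f Mf) (r θ y : ℝ)
    (hr : 0 < r) (hr1 : r ≠ 1) (h1 : Real.arctan b₀ < θ) (h2 : θ < Real.pi / 2) :
    |fPolar f r θ y| ≤ Mf * r ^ (δ - 1) ∧ |fPolar f r θ y| ≤ Mf * r ^ (δ₀ - 2) := by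
  have hm := h_mem b₀ r θ y hr h1 h2
  have hx := h_rx_mk3 r θ y hr.le
  obtain ⟨⟨w1, w2⟩, -⟩ := hw
  unfold fPolar
  rcases lt_or_gt_of_ne hr1 with h | h
  · have := w1 0 (by norm_num) _ hm (by rw [hx]; exact hr) (by rw [hx]; exact h)
    rw [hx, norm_iteratedFDerivWithin_zero, Nat.cast_zero, add_zero, max_eq_left (by linarith),
      Real.norm_eq_abs, mul_comm, ← le_div_iff₀ (by positivity), div_eq_mul_inv,
      ← Real.rpow_neg hr.le, neg_sub] at this
    refine ⟨this, this.trans ?_⟩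
    have := Real.rpow_le_rpow_of_exponent_ge hr h.le (show δ₀ - 2 ≤ δ - 1 by linarith)
    gcongr
  · have := w2 0 (by norm_num) _ hm (by rw [hx]; exact h)
    rw [hx, norm_iteratedFDerivWithin_zero, Nat.cast_zero, add_zero, 
      Real.norm_eq_abs, mul_comm, ← le_div_iff₀ (by positivity), div_eq_mul_inv,
      ← Real.rpow_neg hr.le, neg_sub] at this
    refine ⟨this.trans ?_, this⟩
    have := Real.rpow_le_rpow_of_exponent_le h.le (show δ₀ - 2 ≤ δ - 1 by linarith)
    gcongr

theorem h_int_bound (b₀ B : ℝ) (g : ℝ → ℝ → ℝ)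
    (hg : ∀ θ y, Real.arctan b₀ < θ → θ < Real.pi / 2 → |g θ y| ≤ B) :
    |∫ θ in (Real.arctan b₀)..(Real.pi / 2), ∫ y in (0:ℝ)..(2 * Real.pi), g θ y| ≤
      2 * Real.pi * B * (Real.pi / 2 - Real.arctan b₀) := by
  have hpi := Real.pi_pos
  have hΔ : 0 < Real.pi / 2 - Real.arctan b₀ := by linarith [Real.arctan_lt_pi_div_two b₀]
  have := intervalIntegral.norm_integral_le_of_norm_le_const_ae (a := Real.arctan b₀)
    (b := Real.pi / 2) (C := 2 * Real.pi * B)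
    (f := fun θ => ∫ y in (0:ℝ)..(2 * Real.pi), g θ y) ?_
  · rwa [abs_of_pos hΔ, Real.norm_eq_abs] at this
  · have hne : ∀ᵐ θ : ℝ, θ ≠ Real.pi / 2 := by simp [ae_iff]
    filter_upwards [hne] with θ hθ hmem
    rw [uIoc_of_le (by linarith)] at hmem
    have := intervalIntegral.norm_integral_le_of_norm_le_const (a := 0) (b := 2 * Real.pi)
      (f := fun y => g θ y) (C := B)
      (fun y _ => hg θ y hmem.1 (lt_of_le_of_ne hmem.2 hθ))
    rw [sub_zero, abs_of_pos (by positivity)] at this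
    linarith

theorem h_f0n2 (b₀ B : ℝ) (f : V3 → ℝ) (n : ℕ) (r : ℝ)
    (h : ∀ θ y, Real.arctan b₀ < θ → θ < Real.pi / 2 → |fPolar f r θ y| ≤ B) :
    |f0n2 b₀ f n r| ≤ 2 * B := by
  have hpi := Real.pi_pos
  have hΔ : 0 < Real.pi / 2 - Real.arctan b₀ := by linarith [Real.arctan_lt_pi_div_two b₀]
  unfold f0n2
  rw [abs_mul, abs_of_pos (by positivity), inv_mul_le_iff₀ (by positivity)]
  refine (h_int_bound b₀ B (fun θ y => fPolar f r θ y * Real.cos (n * y)) ?_).trans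
    (le_of_eq (by ring))
  intro θ y h1 h2
  rw [abs_mul]
  exact (mul_le_of_le_one_right (abs_nonneg _) (Real.abs_cos_le_one _)).trans (h θ y h1 h2)

theorem h_f00 (b₀ B : ℝ) (f : V3 → ℝ) (r : ℝ)
    (h : ∀ θ y, Real.arctan b₀ < θ → θ < Real.pi / 2 → |fPolar f r θ y| ≤ B) :
    |f00 b₀ f r| ≤ B := by
  have hpi := Real.pi_pos
  have hΔ : 0 < Real.pi / 2 - Real.arctan b₀ := by linarith [Real.arctan_lt_pi_div_two b₀]
  unfold f00
  rw [abs_mul, abs_of_pos (by positivity), inv_mul_le_iff₀ (by positivity)]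
  exact (h_int_bound b₀ B (fun θ y => fPolar f r θ y) h).trans (le_of_eq (by ring))

theorem h_double (δ₀ Mf : ℝ) (hδ₀0 : 0 < δ₀) (F : ℝ → ℝ)
    (hF : ∀ ξ, 0 < ξ → ξ ≠ 1 → |F ξ| ≤ Mf * ξ ^ (δ₀ - 2)) (r : ℝ) (hr : 0 < r) :
    |∫ η in (0:ℝ)..r, η⁻¹ * ∫ ξ in (0:ℝ)..η, ξ * F ξ| ≤ Mf * r ^ δ₀ / δ₀ ^ 2 := by
  have hne : ∀ᵐ θ : ℝ, θ ≠ 1 := by simp [ae_iff]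
  have hin : ∀ η, 0 < η → |∫ ξ in (0:ℝ)..η, ξ * F ξ| ≤ Mf * η ^ δ₀ / δ₀ := by
    intro η hη
    have := intervalIntegral.norm_integral_le_of_norm_le (a := 0) (b := η) hη.le
      (f := fun ξ => ξ * F ξ) (g := fun ξ => Mf * ξ ^ (δ₀ - 1)) (μ := volume) ?_ ?_
    · rw [intervalIntegral.integral_const_mul, integral_rpow (Or.inl (by linarith))] at this
      simp only [sub_add_cancel, Real.zero_rpow hδ₀0.ne', sub_zero] at this
      rw [Real.norm_eq_abs] at this
      rwa [mul_div_assoc]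
    · filter_upwards [hne] with ξ h1 h2
      have := hF ξ h2.1 h1
      rw [norm_mul, Real.norm_of_nonneg h2.1.le, Real.norm_eq_abs]
      have h3 := mul_le_mul_of_nonneg_left this h2.1.le
      refine h3.trans (le_of_eq ?_)
      rw [show δ₀ - 1 = 1 + (δ₀ - 2) by ring, Real.rpow_add h2.1, Real.rpow_one]; ring
    · exact (intervalIntegral.intervalIntegrable_rpow' (by linarith)).const_mul _
  have := intervalIntegral.norm_integral_le_of_norm_le (a := 0) (b := r) hr.le
    (f := fun η => η⁻¹ * ∫ ξ in (0:ℝ)..η, ξ * F ξ)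
    (g := fun ξ => Mf / δ₀ * ξ ^ (δ₀ - 1)) (μ := volume) ?_ ?_
  · rw [intervalIntegral.integral_const_mul, integral_rpow (Or.inl (by linarith))] at this
    simp only [sub_add_cancel, Real.zero_rpow hδ₀0.ne', sub_zero] at this
    rw [Real.norm_eq_abs] at this
    refine this.trans (le_of_eq ?_)
    field_simp
  · refine Eventually.of_forall (fun η h2 => ?_)
    have h0 : 0 < η := h2.1
    rw [norm_mul, Real.norm_of_nonneg (inv_nonneg.2 h0.le), Real.norm_eq_abs]
    have h3 := mul_le_mul_of_nonneg_left (hin η h0) (inv_nonneg.2 h0.le)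
    refine h3.trans (le_of_eq ?_)
    rw [Real.rpow_sub h0, Real.rpow_one]; field_simp
  · exact (intervalIntegral.intervalIntegrable_rpow' (by linarith)).const_mul _

theorem h_term2 (δ Mf L : ℝ) (hδ0 : 0 < δ) (hM : 0 ≤ Mf) (hL : 4 ≤ L) (n : ℕ) (hn : 1 ≤ n)
    (F : ℝ → ℝ) (hF : ∀ ξ, 0 < ξ → ξ ≠ 1 → |F ξ| ≤ 2 * (Mf * ξ ^ (δ - 1))) :
    |∫ s in (0:ℝ)..L, s * besselK0 (n * s) * F s| ≤
      4 * Mf * Real.Gamma (δ + 1 / 2) * (1 / (n:ℝ) ^ (1 + δ)) := by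
  have hn0 : (0:ℝ) < n := by exact_mod_cast hn
  have hne : ∀ᵐ θ : ℝ, θ ≠ 1 := by simp [ae_iff]
  have hL0 : (0:ℝ) ≤ L := by linarith
  set c : ℝ := 4 * Mf * (n:ℝ) ^ (-(1:ℝ)/2) with hc
  have hc0 : 0 ≤ c := by positivity
  have hval := Real.integral_rpow_mul_exp_neg_mul_Ioi (a := δ + 1 / 2) (r := n) (by linarith) hn0
  have hpos : 0 < (1 / (n:ℝ)) ^ (δ + 1 / 2) * Real.Gamma (δ + 1 / 2) :=
    mul_pos (by positivity) (Real.Gamma_pos_of_pos (by linarith))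
  have hIntble : IntegrableOn (fun t : ℝ => t ^ (δ + 1 / 2 - 1) * Real.exp (-(n * t))) (Ioi 0) := by
    by_contra hcon
    have := integral_undef hcon
    rw [hval] at this
    exact hpos.ne' this
  have := intervalIntegral.norm_integral_le_of_norm_le (a := 0) (b := L) hL0
    (f := fun s => s * besselK0 (n * s) * F s)
    (g := fun t => c * (t ^ (δ + 1 / 2 - 1) * Real.exp (-(n * t)))) (μ := volume) ?_ ?_
  · rw [Real.norm_eq_abs] at this
    refine this.trans ?_
    rw [intervalIntegral.integral_const_mul, intervalIntegral.integral_of_le hL0]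
    have h1 : ∫ t in Ioc 0 L, t ^ (δ + 1 / 2 - 1) * Real.exp (-(n * t)) ≤
        ∫ t in Ioi 0, t ^ (δ + 1 / 2 - 1) * Real.exp (-(n * t)) := by
      refine setIntegral_mono_set hIntble ?_ (Ioc_subset_Ioi_self.eventuallyLE)
      filter_upwards [ae_restrict_mem measurableSet_Ioi] with t ht
      have ht' : 0 < t := ht
      simp only [Pi.zero_apply]
      positivity
    refine (mul_le_mul_of_nonneg_left h1 hc0).trans (le_of_eq ?_)
    rw [hval, hc, one_div (n:ℝ), Real.inv_rpow hn0.le, ← Real.rpow_neg hn0.le,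
      one_div ((n:ℝ) ^ (1 + δ)), ← Real.rpow_neg hn0.le, show -(1 + δ) = -(1:ℝ)/2 + -(δ + 1/2) by ring, Real.rpow_add hn0]
    ring
  · filter_upwards [hne] with s h1 h2
    have hs : 0 < s := h2.1
    obtain ⟨k1, k2⟩ := h_K0_bound (n * s) (by positivity)
    have h3 := hF s hs h1
    rw [norm_mul, norm_mul, Real.norm_of_nonneg hs.le, Real.norm_of_nonneg k1, Real.norm_eq_abs]
    calc _ ≤ s * (2 * Real.exp (-(n * s)) * (n * s) ^ (-(1:ℝ)/2)) * (2 * (Mf * s ^ (δ - 1))) := by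
          gcongr
      _ = _ := by
        rw [Real.mul_rpow hn0.le hs.le, hc,
          show δ + 1 / 2 - 1 = 1 + (-(1:ℝ)/2) + (δ - 1) by ring, Real.rpow_add hs,
          Real.rpow_add hs, Real.rpow_one]
        ring
  · rw [intervalIntegrable_iff_integrableOn_Ioc_of_le hL0]
    exact (hIntble.mono_set Ioc_subset_Ioi_self).const_mul _

theorem h_term1 (δ Mf L : ℝ) (hδ0 : 0 < δ) (hδ1 : δ < 1) (hM : 0 ≤ Mf) (hL : 4 ≤ L) (n : ℕ)
    (F : ℝ → ℝ) (hF : ∀ ξ, 0 < ξ → ξ ≠ 1 → |F ξ| ≤ 2 * (Mf * ξ ^ (δ - 1))) :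
    |∫ s in (0:ℝ)..L, s * besselI0 (n * s) * F s| ≤ 2 * Mf * Real.exp (n * L) * L ^ 2 := by
  have hne : ∀ᵐ θ : ℝ, θ ≠ 1 := by simp [ae_iff]
  have hL0 : (0:ℝ) ≤ L := by linarith
  have := intervalIntegral.norm_integral_le_of_norm_le_const_ae (a := 0) (b := L)
    (f := fun s => s * besselI0 (n * s) * F s) (C := 2 * Mf * Real.exp (n * L) * L) ?_
  · rw [Real.norm_eq_abs, sub_zero, abs_of_nonneg hL0] at this
    exact this.trans (le_of_eq (by ring))
  · filter_upwards [hne] with s h1 h2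
    rw [uIoc_of_le hL0] at h2
    have hs : 0 < s := h2.1
    have k1 := h_I0_nonneg (n * s)
    have k2 := h_I0_le (n * s) (by positivity)
    have k3 : Real.exp (n * s) ≤ Real.exp (n * L) := Real.exp_le_exp.2 (by gcongr; exact h2.2)
    have h3 := hF s hs h1
    have h4 : s * s ^ (δ - 1) ≤ L := by
      have : s * s ^ (δ - 1) = s ^ δ := by
        rw [Real.rpow_sub hs, Real.rpow_one]; field_simp
      rw [this]
      calc s ^ δ ≤ L ^ δ := by gcongr; exact h2.2
        _ ≤ L ^ (1:ℝ) := Real.rpow_le_rpow_of_exponent_le (by linarith) hδ1.le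
        _ = L := Real.rpow_one L
    rw [norm_mul, norm_mul, Real.norm_of_nonneg hs.le, Real.norm_of_nonneg k1, Real.norm_eq_abs]
    calc _ ≤ s * Real.exp (n * L) * (2 * (Mf * s ^ (δ - 1))) := by
          gcongr; exact k2.trans k3
      _ = 2 * Mf * Real.exp (n * L) * (s * s ^ (δ - 1)) := by ring
      _ ≤ _ := by gcongr

/-- Lemma A.3: `‖R₀₀‖^{(0,−δ₀)}_{0;Q_L} ≤ C‖f‖^{(1−δ,2−δ₀)}_{1,α;Q}` with `C` independent
of `L` and `f` (and the series defining `R₀₀(r)` converges absolutely). -/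
theorem stmt19 (b₀ α δ δ₀ : ℝ) (hb₀ : 0 < b₀) (hα0 : 0 < α) (hα1 : α < 1)
    (hδ0 : 0 < δ) (hδ1 : δ < 1) (hδ₀0 : 0 < δ₀) (hδ₀1 : δ₀ < 1) :
    ∃ C : ℝ, 0 < C ∧
      ∀ L : ℝ, 4 ≤ L →
      ∀ (f : V3 → ℝ) (Mf : ℝ), 0 ≤ Mf →
        ContDiffOn ℝ 1 f (SQ b₀) →
        wnormLE (SQ b₀) 1 α (1 - δ) (2 - δ₀) (wedgeQ b₀) f Mf →
        Per2On (closure (wedgeQ b₀)) f →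
        (Summable fun n : ℕ => |R0n2At0 b₀ L f (n + 1)|) ∧
        (∀ r : ℝ, 0 < r → r ≤ 1 → |R00 b₀ L f r| ≤ C * Mf) ∧
        (∀ r : ℝ, 1 < r → r ≤ L → r ^ (-δ₀) * |R00 b₀ L f r| ≤ C * Mf) := by
  obtain ⟨A, hA, hratio⟩ := h_ratio
  have hG : 0 < Real.Gamma (δ + 1 / 2) := Real.Gamma_pos_of_pos (by linarith)
  set b : ℕ → ℝ := fun n => 2 * A * (1 / ((n + 1 : ℕ) : ℝ) ^ 2) +
    4 * Real.Gamma (δ + 1 / 2) * (1 / ((n + 1 : ℕ) : ℝ) ^ (1 + δ)) with hb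
  have hbs : Summable b := by
    have s1 := (summable_nat_add_iff 1).2
      (Real.summable_one_div_nat_pow (p := 2).2 (by norm_num))
    have s2 := (summable_nat_add_iff 1).2
      (Real.summable_one_div_nat_rpow (p := 1 + δ).2 (by linarith))
    exact (s1.mul_left _).add (s2.mul_left _)
  have hb0 : 0 ≤ ∑' n, b n := tsum_nonneg (fun n => by simp only [hb]; positivity)
  refine ⟨(∑' n, b n) + 1 / δ₀ ^ 2, by positivity, ?_⟩
  intro L hL f Mf hM _ hw _
  have hf := h_f_bound b₀ α δ δ₀ hδ0 hδ1 hδ₀0 hδ₀1 f Mf hM hw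
  have hL0 : 0 < L := by linarith
  have hR : ∀ n : ℕ, |R0n2At0 b₀ L f (n + 1)| ≤ Mf * b n := by
    intro n
    have hn : (1:ℝ) ≤ ((n + 1 : ℕ) : ℝ) := by push_cast; linarith [(Nat.cast_nonneg n : (0:ℝ) ≤ n)]
    have hF : ∀ ξ, 0 < ξ → ξ ≠ 1 → |f0n2 b₀ f (n + 1) ξ| ≤ 2 * (Mf * ξ ^ (δ - 1)) :=
      fun ξ h0 h1 => h_f0n2 b₀ _ f (n + 1) ξ (fun θ y t1 t2 => (hf ξ θ y h0 h1 t1 t2).1)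
    have t2 := h_term2 δ Mf L hδ0 hM hL (n + 1) (by omega) _ hF
    have t1 := h_term1 δ Mf L hδ0 hδ1 hM hL (n + 1) _ hF
    have t3 := hratio (((n + 1 : ℕ) : ℝ) * L) (by nlinarith)
    unfold R0n2At0
    refine (abs_sub _ _).trans ?_
    rw [abs_mul]
    have t4 := mul_le_mul t3 t1 (abs_nonneg _) (by positivity)
    refine (add_le_add t4 t2).trans (le_of_eq ?_)
    have hn0 : (((n + 1 : ℕ) : ℝ)) ≠ 0 := by positivity
    simp only [hb]
    generalize ((n + 1 : ℕ) : ℝ) = N at hn0 ⊢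
    rw [Real.exp_neg]
    have := (Real.exp_pos (N * L)).ne'
    field_simp
  have hS : Summable fun n : ℕ => |R0n2At0 b₀ L f (n + 1)| :=
    Summable.of_nonneg_of_le (fun _ => abs_nonneg _) hR (hbs.mul_left _)
  have hT : |∑' n : ℕ, R0n2At0 b₀ L f (n + 1)| ≤ Mf * ∑' n, b n := by
    have := tsum_of_norm_bounded (hbs.hasSum.mul_left Mf) (f := fun n : ℕ => R0n2At0 b₀ L f (n + 1)) hR
    simpa using this
  have hD : ∀ r : ℝ, 0 < r → |R00 b₀ L f r| ≤ Mf * (∑' n, b n) + Mf * r ^ δ₀ / δ₀ ^ 2 := by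
    intro r hr
    have := h_double δ₀ Mf hδ₀0 (f00 b₀ f)
      (fun ξ h0 h1 => h_f00 b₀ _ f ξ (fun θ y t1 t2 => (hf ξ θ y h0 h1 t1 t2).2)) r hr
    unfold R00
    refine (abs_add_le _ _).trans ?_
    rw [abs_neg]
    exact add_le_add hT this
  refine ⟨hS, ?_, ?_⟩
  · intro r hr hr1
    refine (hD r hr).trans ?_
    have : r ^ δ₀ ≤ 1 := Real.rpow_le_one hr.le hr1 hδ₀0.le
    calc _ ≤ Mf * (∑' n, b n) + Mf * 1 / δ₀ ^ 2 := by gcongr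
      _ = _ := by ring
  · intro r hr hrL
    have hr0 : 0 < r := by linarith
    have h1 : r ^ (-δ₀) ≤ 1 := Real.rpow_le_one_of_one_le_of_nonpos hr.le (by linarith)
    have h2 : r ^ (-δ₀) * r ^ δ₀ = 1 := by rw [← Real.rpow_add hr0]; simp
    calc _ ≤ r ^ (-δ₀) * (Mf * (∑' n, b n) + Mf * r ^ δ₀ / δ₀ ^ 2) := by
          gcongr; exact hD r hr0
      _ = r ^ (-δ₀) * (Mf * (∑' n, b n)) + Mf * (r ^ (-δ₀) * r ^ δ₀) / δ₀ ^ 2 := by ring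
      _ ≤ 1 * (Mf * (∑' n, b n)) + Mf * (r ^ (-δ₀) * r ^ δ₀) / δ₀ ^ 2 := by gcongr
      _ = _ := by rw [h2]; ring
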